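/- The determinant of the 10×10 Gram matrix G_2^{(Mb)_1} (with entries in ℤ[d, z, x, y, w] as listed in Table 1) equals (d−z)⁴ · (T_1-shifted factors) namely: (d−2)·d²·(d+2)·(d−z)⁴·(d²−2−z)·(d²−2+z)·(−dw + 2xy − wz)⁴, which can be rewritten as (T_1(d)−z)⁴ · (T_2(d)²−z²) · ((d+z)w − 2xy)⁴ · (T_4(d)−2). -/

import Mathlib

/-- Chebyshev polynomials of the first kind with normalization `T 0 = 2`. -/
def cheb {R : Type*} [CommRing R] (d : R) : ℕ → R
  | 0 => 2
  | 1 => d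
  | n + 2 => d * cheb d (n + 1) - cheb d n

namespace Matrix

section Blocks

variable {m n R : Type*} [Fintype m] [DecidableEq m] [Fintype n] [DecidableEq n] [CommRing R]

theorem det_fromBlocks_self_swap (P Q : Matrix n n R) :
    (fromBlocks P Q Q P).det = (P + Q).det * (P - Q).det := by
  have key : fromBlocks (1 : Matrix n n R) 1 0 1 * fromBlocks P Q Q P =
      fromBlocks (P + Q) 0 Q (P - Q) * fromBlocks 1 1 0 1 := by
    simp [fromBlocks_multiply, add_comm]
  simpa using congrArg det key

/-- A Schur complement formula for blocks `C` with `s • C = K * A`, avoiding inverses. -/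
theorem pow_card_mul_det_fromBlocks {s : R} {A : Matrix m m R} {C K : Matrix n m R}
    (h : s • C = K * A) (B : Matrix m n R) (D : Matrix n n R) :
    s ^ Fintype.card n * (fromBlocks A B C D).det = A.det * (s • D - K * B).det := by
  have key : fromBlocks 1 0 (-K) (s • (1 : Matrix n n R)) * fromBlocks A B C D =
      fromBlocks A B 0 (s • D - K * B) := by
    simp [fromBlocks_multiply, h, sub_eq_neg_add]
  simpa using congrArg det key

end Blocks

end Matrix

open Matrix in
/-- The Gram determinant of the six crosscap-avoiding connections. -/
theorem det_gram_avoiding_crosscap {R : Type*} [CommRing R] (d z : R) :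
    (!![d^2, d*z, z^2, z,   d,   z;
        d*z, d^2, d*z, d,   z,   d;
        z^2, d*z, d^2, z,   d,   z;
        z,   d,   z,   d^2, d*z, z^2;
        d,   z,   d,   d*z, d^2, d*z;
        z,   d,   z,   z^2, d*z, d^2] : Matrix (Fin 6) (Fin 6) R).det =
      (d + z)^4 * (d - z)^4 * ((d^2 - 2)^2 - z^2) := by
  rw [← det_submatrix_equiv_self (finSumFinEquiv (m := 3) (n := 3)),
    show Matrix.submatrix _ (finSumFinEquiv (m := 3) (n := 3)) finSumFinEquiv =
      fromBlocks !![d^2, d*z, z^2; d*z, d^2, d*z; z^2, d*z, d^2] !![z, d, z; d, z, d; z, d, z]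
        !![z, d, z; d, z, d; z, d, z] !![d^2, d*z, z^2; d*z, d^2, d*z; z^2, d*z, d^2] by
      ext (i | i) (j | j) <;> fin_cases i <;> fin_cases j <;> rfl,
    det_fromBlocks_self_swap, det_fin_three, det_fin_three]
  simp
  ring

theorem det_gram_circle_four {R : Type*} [CommRing R] (d t : R) :
    (!![d*t, t, 0, t; t, d*t, t, 0; 0, t, d*t, t; t, 0, t, d*t] : Matrix (Fin 4) (Fin 4) R).det =
      t^4 * (d^2 * (d^2 - 4)) := by
  simp [Matrix.det_succ_row_zero, Fin.sum_univ_succ, Fin.succAbove]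
  ring

open Matrix in
theorem pow_four_mul_det_gram {R : Type*} [CommRing R] (d z x y w : R) :
    (d + z)^4 * (!![d^2, d*z, z^2, z,   d,   z,   d*y, y,   y*z, y;
         d*z, d^2, d*z, d,   z,   d,   d*y, y,   d*y, y;
         z^2, d*z, d^2, z,   d,   z,   y*z, y,   d*y, y;
         z,   d,   z,   d^2, d*z, z^2, y,   y*z, y,   d*y;
         d,   z,   d,   d*z, d^2, d*z, y,   d*y, y,   d*y;
         z,   d,   z,   z^2, d*z, d^2, y,   d*y, y,   y*z;
         d*x, d*x, x*z, x,   x,   x,   d*w, w,   x*y, w;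
         x,   x,   x,   x*z, d*x, d*x, w,   d*w, w,   x*y;
         x*z, d*x, d*x, x,   x,   x,   x*y, w,   d*w, w;
         x,   x,   x,   d*x, d*x, x*z, w,   x*y, w,   d*w] : Matrix (Fin 10) (Fin 10) R).det =
      (d + z)^4 * ((d - z)^4 * ((d^2 - 2)^2 - z^2) *
        (((d + z)*w - 2*x*y)^4 * (d^2 * (d^2 - 4)))) := by
  rw [← mul_assoc, ← mul_assoc ((d + z)^4), ← det_gram_avoiding_crosscap, ← det_gram_circle_four,
    ← det_submatrix_equiv_self (finSumFinEquiv (m := 6) (n := 4))]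
  rw [show Matrix.submatrix _ (finSumFinEquiv (m := 6) (n := 4)) finSumFinEquiv =
      fromBlocks
        !![d^2, d*z, z^2, z,   d,   z;
           d*z, d^2, d*z, d,   z,   d;
           z^2, d*z, d^2, z,   d,   z;
           z,   d,   z,   d^2, d*z, z^2;
           d,   z,   d,   d*z, d^2, d*z;
           z,   d,   z,   z^2, d*z, d^2]
        !![d*y, y,   y*z, y;
           d*y, y,   d*y, y;
           y*z, y,   d*y, y;
           y,   y*z, y,   d*y;
           y,   d*y, y,   d*y;
           y,   d*y, y,   y*z]
        !![d*x, d*x, x*z, x,   x,   x;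
           x,   x,   x,   x*z, d*x, d*x;
           x*z, d*x, d*x, x,   x,   x;
           x,   x,   x,   d*x, d*x, x*z]
        !![d*w, w,   x*y, w;
           w,   d*w, w,   x*y;
           x*y, w,   d*w, w;
           w,   x*y, w,   d*w] by
      ext (i | i) (j | j) <;> fin_cases i <;> fin_cases j <;> rfl]
  refine (pow_card_mul_det_fromBlocks (s := d + z)
    (K := !![x, x, 0, 0, 0, 0; 0, 0, 0, 0, x, x; 0, x, x, 0, 0, 0; 0, 0, 0, x, x, 0])
    ?_ _ _).trans ?_
  · ext i j
    fin_cases i <;> fin_cases j <;> simp [Matrix.mul_apply, Fin.sum_univ_succ] <;> ring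
  · congr 2
    ext i j
    fin_cases i <;> fin_cases j <;> simp <;> ring

open MvPolynomial in
/-- The determinant of the 10×10 Gram matrix `G_2^{(Mb)_1}` of Table 1. -/
theorem gram_det_Mb1_two :
    letI d : MvPolynomial (Fin 5) ℤ := X 0
    letI z : MvPolynomial (Fin 5) ℤ := X 1
    letI x : MvPolynomial (Fin 5) ℤ := X 2
    letI y : MvPolynomial (Fin 5) ℤ := X 3
    letI w : MvPolynomial (Fin 5) ℤ := X 4
    letI G : Matrix (Fin 10) (Fin 10) (MvPolynomial (Fin 5) ℤ) :=
      !![d^2, d*z, z^2, z,   d,   z,   d*y, y,   y*z, y;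
         d*z, d^2, d*z, d,   z,   d,   d*y, y,   d*y, y;
         z^2, d*z, d^2, z,   d,   z,   y*z, y,   d*y, y;
         z,   d,   z,   d^2, d*z, z^2, y,   y*z, y,   d*y;
         d,   z,   d,   d*z, d^2, d*z, y,   d*y, y,   d*y;
         z,   d,   z,   z^2, d*z, d^2, y,   d*y, y,   y*z;
         d*x, d*x, x*z, x,   x,   x,   d*w, w,   x*y, w;
         x,   x,   x,   x*z, d*x, d*x, w,   d*w, w,   x*y;
         x*z, d*x, d*x, x,   x,   x,   x*y, w,   d*w, w;
         x,   x,   x,   d*x, d*x, x*z, w,   x*y, w,   d*w]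
    G.det = (d - 2) * d^2 * (d + 2) * (d - z)^4 * (d^2 - 2 - z) * (d^2 - 2 + z) *
        (-(d*w) + 2*x*y - w*z)^4 ∧
      G.det = (cheb d 1 - z)^4 * ((cheb d 2)^2 - z^2) * ((d + z)*w - 2*x*y)^4 *
        (cheb d 4 - 2) := by
  have hne : (X 0 + X 1 : MvPolynomial (Fin 5) ℤ) ≠ 0 := fun h => by
    simpa using congrArg (eval fun _ => 1) h
  have hdet := mul_left_cancel₀ (pow_ne_zero 4 hne)
    (pow_four_mul_det_gram (X 0 : MvPolynomial (Fin 5) ℤ) (X 1) (X 2) (X 3) (X 4))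
  refine ⟨hdet.trans ?_, hdet.trans ?_⟩
  · ring
  · simp only [cheb]
    ring
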